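/- arXiv:1701.04993 — 3 statements merged into one kernel-verified Lean document; each statement's English description precedes it below -/
import Mathlib

section
/- For real numbers x_1, …, x_m and a natural number k, the falling factorial satisfies the multinomial theorem: (x_1 + ⋯ + x_m)_k = ∑_{k_1+⋯+k_m = k} k!/(k_1!⋯k_m!) · (x_1)_{k_1} ⋯ (x_m)_{k_m}. -/
/-- The falling factorial `(x)_n = x (x-1) ⋯ (x-n+1)`, with `(x)_0 = 1`. -/
def fallingFactorial (x : ℝ) (n : ℕ) : ℝ := ∏ i ∈ Finset.range n, (x - i)

theorem ff_eq_choose (x : ℝ) (k : ℕ) :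
    fallingFactorial x k = (k.factorial : ℝ) * Ring.choose x k := by
  have h := Ring.descPochhammer_eq_factorial_smul_choose x k
  rw [nsmul_eq_mul] at h
  rw [← h]
  unfold fallingFactorial
  induction k with
  | zero => simp
  | succ n ih =>
    rw [Finset.prod_range_succ, ih (by rw [Ring.descPochhammer_eq_factorial_smul_choose x n, nsmul_eq_mul]),
      descPochhammer_succ_right, Polynomial.smeval_mul]
    simp [Polynomial.smeval_sub, Polynomial.smeval_natCast]

theorem choose_sum (m : ℕ) : ∀ (k : ℕ) (x : Fin m → ℝ),
    Ring.choose (∑ j, x j) k =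
      ∑ d ∈ Finset.Nat.antidiagonalTuple m k, ∏ j, Ring.choose (x j) (d j) := by
  induction m with
  | zero =>
    intro k x
    cases k with
    | zero => simp
    | succ n => simp [Ring.choose_zero_succ]
  | succ m ih =>
    intro k x
    rw [Fin.sum_univ_succ, Ring.add_choose_eq k (Commute.all _ _)]
    simp_rw [ih, Finset.mul_sum]
    rw [Finset.sum_sigma']
    refine Finset.sum_bij' (fun p _ => Fin.cons p.1.1 p.2)
      (fun d _ => ⟨(d 0, ∑ j : Fin m, d j.succ), fun j => d j.succ⟩) ?_ ?_ ?_ ?_ ?_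
    · rintro ⟨⟨a, b⟩, d⟩ h
      simp [Finset.Nat.mem_antidiagonalTuple] at h
      simp [Finset.Nat.mem_antidiagonalTuple, Fin.sum_univ_succ, h]
    · intro d h
      simp [Finset.Nat.mem_antidiagonalTuple, Fin.sum_univ_succ] at h
      simp [Finset.Nat.mem_antidiagonalTuple, h]
    · rintro ⟨⟨a, b⟩, d⟩ h
      simp [Finset.Nat.mem_antidiagonalTuple] at h
      obtain ⟨h1, rfl⟩ := h
      simp
    · intro d h
      exact Fin.cons_self_tail d
    · rintro ⟨⟨a, b⟩, d⟩ h
      simp [Fin.prod_univ_succ]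

theorem stmt_5 (m k : ℕ) (x : Fin m → ℝ) :
    fallingFactorial (∑ j, x j) k =
      ∑ d ∈ Finset.Nat.antidiagonalTuple m k,
        (Nat.multinomial Finset.univ d : ℝ) * ∏ j, fallingFactorial (x j) (d j) := by
  rw [ff_eq_choose, choose_sum, Finset.mul_sum]
  refine Finset.sum_congr rfl fun d hd => ?_
  rw [Finset.Nat.mem_antidiagonalTuple] at hd
  have h := Nat.multinomial_spec Finset.univ d
  rw [hd] at h
  simp_rw [ff_eq_choose]
  rw [Finset.prod_mul_distrib, ← h]
  push_cast
  ring
end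

section
/- Let f be a function from finite multisets of integers to ℚ defined on blocks, and for a multiset A = {a_1,…,a_n} define the transform ψ(p) for a partition p. Then the following inversion holds formally: if for every multiset A one has ψ(A) = ∑_{σ ∈ S_n} κ_{σ(A)} (sum over all permutations, where σ(A) is the multiset of cycle-sums of σ applied to (a_1,…,a_n)), then κ_{a_1}⋯κ_{a_n} = ∑_{p ∈ SP(A)} (-1)^{n + ℓ(p)} ψ(p), where SP(A) is the set of set partitions of the index set, ℓ(p) the number of blocks, and ψ(p) = ψ(|p_1|, …, |p_{ℓ(p)}|) with |p_i| the sum of entries in block p_i. -/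
open Finset

/-- `ψ(x_1,…,x_r) := ∑_{σ ∈ S_r} ∏_{cycles γ of σ} κ_{∑_{j ∈ γ} x_j}`, an element of the
free commutative ℚ-algebra on symbols `κ_m = X m` indexed by `m : ℤ`.  The product runs
over the orbits of `σ` (cycles, including fixed points). -/
noncomputable def psi {ι : Type*} [Fintype ι] [DecidableEq ι] (x : ι → ℤ) :
    MvPolynomial ℤ ℚ :=
  ∑ σ : Equiv.Perm ι,
    ∏ b ∈ Finset.univ.image (fun i => Finset.univ.filter (σ.SameCycle i)),
      MvPolynomial.X (∑ j ∈ b, x j)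

section Helpers

open Classical in
/-- block sums along the fibres of `c` -/
noncomputable def ptSum {ι Q : Type*} [Fintype ι] (c : ι → Q) (a : ι → ℤ) (q : Q) : ℤ :=
  ∑ i ∈ Finset.univ.filter (fun i => c i = q), a i

theorem ptSum_option {ι Q : Type*} [Fintype ι] (c : Option ι → Q) (a : Option ι → ℤ) (q : Q)
    [Decidable (c none = q)] : ptSum c a q =
      (if c none = q then a none else 0) + ptSum (fun i => c (some i)) (fun i => a (some i)) q := by
  unfold ptSum
  rw [Finset.sum_filter, Fintype.sum_option, Finset.sum_filter]
  congr!

theorem ptSum_none {ι Q : Type*} [Fintype ι] (c : ι → Q) (a : ι → ℤ) :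
    ptSum (fun i => some (c i)) a none = 0 := by
  simp [ptSum]

theorem ptSum_some {ι Q : Type*} [Fintype ι] (c : ι → Q) (a : ι → ℤ) (q : Q) :
    ptSum (fun i => some (c i)) a (some q) = ptSum c a q := by
  unfold ptSum
  congr!
  simp

theorem ptSum_add_single {ι Q : Type*} [Fintype ι] [DecidableEq ι] [DecidableEq Q] (c : ι → Q)
    (a : ι → ℤ) (k : ι) (z : ℤ) (q : Q) :
    ptSum c (fun j => a j + if j = k then z else 0) q =
      (if c k = q then z else 0) + ptSum c a q := by
  unfold ptSum
  rw [Finset.sum_add_distrib, add_comm, Finset.sum_ite_eq']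
  simp

theorem sameCycle_rel {ι : Type*} (σ : Equiv.Perm ι) (r : Setoid ι) (h : ∀ i, r i (σ i))
    {i j : ι} (hij : σ.SameCycle i j) : r i j := by
  obtain ⟨k, rfl⟩ := hij
  have h1 : ∀ (n : ℕ) (i : ι), r i ((σ ^ n) i) := by
    intro n
    induction n with
    | zero => intro i; exact r.refl _
    | succ n ih =>
      intro i
      rw [pow_succ', Equiv.Perm.mul_apply]
      exact r.trans (ih i) (h _)
  cases k with
  | ofNat n => simpa using h1 n i
  | negSucc n =>
    have := h1 (n + 1) ((σ ^ (Int.negSucc n)) i)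
    rw [zpow_negSucc, ← Equiv.Perm.mul_apply, mul_inv_cancel, Equiv.Perm.one_apply] at this
    rw [zpow_negSucc]
    exact r.symm this

theorem cyc_prod {ι Q : Type*} [Fintype ι] [DecidableEq ι] [Fintype Q] (σ : Equiv.Perm ι)
    (c : ι → Q) (hs : Function.Surjective c) (h : ∀ i j, σ.SameCycle i j ↔ c i = c j)
    (x : ι → ℤ) :
    ∏ b ∈ Finset.univ.image (fun i => Finset.univ.filter (σ.SameCycle i)),
      (MvPolynomial.X (∑ j ∈ b, x j) : MvPolynomial ℤ ℚ) =
    ∏ q, MvPolynomial.X (ptSum c x q) := by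
  classical
  symm
  refine Finset.prod_bij (fun q _ => Finset.univ.filter (fun i => c i = q)) ?_ ?_ ?_ ?_
  · intro q _
    obtain ⟨i, rfl⟩ := hs q
    simp only [Finset.mem_image, Finset.mem_univ, true_and]
    refine ⟨i, ?_⟩
    ext j
    simp [h, eq_comm]
  · intro q _ q' _ hq
    obtain ⟨i, rfl⟩ := hs q
    have : i ∈ Finset.univ.filter (fun j => c j = c i) := by simp
    rw [hq] at this
    simpa using this
  · intro b hb
    simp only [Finset.mem_image, Finset.mem_univ, true_and] at hb
    obtain ⟨i, rfl⟩ := hb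
    refine ⟨c i, Finset.mem_univ _, ?_⟩
    ext j
    simp [h, eq_comm]
  · intro q _
    unfold ptSum
    congr!

theorem ptSum_comp_equiv {ι κ Q : Type*} [Fintype ι] [Fintype κ] (e : ι ≃ κ) (c : κ → Q)
    (x : κ → ℤ) (q : Q) : ptSum (c ∘ e) (x ∘ e) q = ptSum c x q := by
  classical
  unfold ptSum
  simp only [Finset.sum_filter]
  exact Equiv.sum_comp e (fun i => if c i = q then x i else 0)

theorem psi_congr {ι κ : Type*} [Fintype ι] [DecidableEq ι] [Fintype κ] [DecidableEq κ]
    (e : ι ≃ κ) (x : κ → ℤ) : psi (x ∘ e) = psi x := by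
  classical
  unfold psi
  refine Fintype.sum_equiv e.permCongr _ _ ?_
  intro σ
  have hc : ∀ i j, (e.permCongr σ).SameCycle i j ↔
      (Quotient.mk (Equiv.Perm.SameCycle.setoid (e.permCongr σ)) i = Quotient.mk _ j) := by
    intro i j
    exact Iff.symm Quotient.eq
  rw [cyc_prod (e.permCongr σ) _ Quotient.mk_surjective hc]
  rw [cyc_prod σ (Quotient.mk (Equiv.Perm.SameCycle.setoid (e.permCongr σ)) ∘ e)
    (Quotient.mk_surjective.comp e.surjective)]
  · simp only [ptSum_comp_equiv]
  · intro i j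
    simp only [Function.comp]
    rw [← hc]
    constructor
    · exact fun hij => sameCycle_rel σ
        ((Equiv.Perm.SameCycle.setoid (e.permCongr σ)).comap e) (fun i => ⟨1, by simp⟩) hij
    · intro hij
      have := sameCycle_rel (e.permCongr σ) ((Equiv.Perm.SameCycle.setoid σ).comap e.symm)
        (fun i => ⟨1, by simp⟩) hij
      rw [Setoid.comap_rel, Equiv.symm_apply_apply, Equiv.symm_apply_apply] at this
      exact this

theorem psi_option {ι : Type*} [Fintype ι] [DecidableEq ι] (y : Option ι → ℤ) :
    psi y = MvPolynomial.X (y none) * psi (fun i => y (some i)) +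
      ∑ i, psi (fun j => y (some j) + if j = i then y none else 0) := by
  classical
  unfold psi
  rw [← Equiv.sum_comp Equiv.Perm.decomposeOption.symm, Fintype.sum_prod_type,
    Fintype.sum_option, Finset.mul_sum]
  congr 1
  · refine Finset.sum_congr rfl fun σ _ => ?_
    let c : ι → Quotient (Equiv.Perm.SameCycle.setoid σ) := Quotient.mk _
    have hc : ∀ i j, σ.SameCycle i j ↔ c i = c j := fun i j => Iff.symm Quotient.eq
    have hsc : Function.Surjective c := Quotient.mk_surjective
    rw [cyc_prod σ c hsc hc]
    have hsm : Function.Surjective (Option.map c) := fun q => by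
      cases q with
      | none => exact ⟨none, rfl⟩
      | some q =>
        obtain ⟨i, rfl⟩ := hsc q
        exact ⟨some i, rfl⟩
    rw [cyc_prod _ (Option.map c) hsm]
    · rw [Fintype.prod_option]
      congr 1
      · rw [ptSum_option]
        simp [ptSum_none]
      · refine Finset.prod_congr rfl fun q _ => ?_
        rw [ptSum_option]
        simp [ptSum_some]
    · intro i j
      constructor
      · intro hij
        refine sameCycle_rel _ (Setoid.ker (Option.map c)) ?_ hij
        intro i
        cases i with
        | none => simp [Setoid.ker_def]
        | some i =>
          simp only [Setoid.ker_def, Equiv.Perm.decomposeOption_symm_of_none_apply,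
            Option.map_some, Option.some.injEq]
          exact (hc _ _).1 ⟨1, by simp⟩
      · intro hij
        cases i with
        | none =>
          cases j with
          | none => exact Equiv.Perm.SameCycle.refl _ _
          | some j => simp at hij
        | some i =>
          cases j with
          | none => simp at hij
          | some j =>
            simp only [Option.map_some, Option.some.injEq] at hij
            exact sameCycle_rel σ ((Equiv.Perm.SameCycle.setoid
              (Equiv.Perm.decomposeOption.symm (none, σ))).comap some)
              (fun i => ⟨1, by simp⟩) ((hc _ _).2 hij)
  · refine Finset.sum_congr rfl fun k _ => ?_
    refine Finset.sum_congr rfl fun σ _ => ?_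
    let c : ι → Quotient (Equiv.Perm.SameCycle.setoid σ) := Quotient.mk _
    have hc : ∀ i j, σ.SameCycle i j ↔ c i = c j := fun i j => Iff.symm Quotient.eq
    have hsc : Function.Surjective c := Quotient.mk_surjective
    let c' : Option ι → Quotient (Equiv.Perm.SameCycle.setoid σ) := fun o => o.elim (c k) c
    have hsc' : Function.Surjective c' := fun q => by
      obtain ⟨i, rfl⟩ := hsc q
      exact ⟨some i, rfl⟩
    rw [cyc_prod σ c hsc hc]
    rw [cyc_prod _ c' hsc']
    · refine Finset.prod_congr rfl fun q _ => ?_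
      congr 1
      rw [ptSum_add_single, ptSum_option]
      rfl
    · set τ := Equiv.Perm.decomposeOption.symm (some k, σ) with hτ
      have hτn : τ none = some k := by simp [hτ]
      have hτ1 : ∀ i, σ i = k → τ (some i) = none := by intro i hi; simp [hτ, hi]
      have hτ2 : ∀ i, σ i ≠ k → τ (some i) = some (σ i) := by
        intro i hi
        simp only [hτ, Equiv.Perm.decomposeOption_symm_apply, Equiv.Perm.mul_apply,
          Equiv.optionCongr_apply, Option.map_some]
        rw [Equiv.swap_apply_of_ne_of_ne (by simp) (by simpa using hi)]
      have hsome : ∀ i j, c i = c j → τ.SameCycle (some i) (some j) := by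
        intro i j hij
        refine sameCycle_rel σ ((Equiv.Perm.SameCycle.setoid τ).comap some) ?_ ((hc _ _).2 hij)
        intro i
        by_cases hi : σ i = k
        · refine ⟨2, ?_⟩
          rw [zpow_ofNat, pow_two, Equiv.Perm.mul_apply, hτ1 i hi, hτn, hi]
        · refine ⟨1, ?_⟩
          rw [zpow_one, hτ2 i hi]
      have hnk : τ.SameCycle none (some k) := ⟨1, by rw [zpow_one, hτn]⟩
      intro i j
      constructor
      · intro hij
        refine sameCycle_rel _ (Setoid.ker c') ?_ hij
        intro i
        cases i with
        | none => rw [hτn]; rfl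
        | some i =>
          have h1 : c i = c (σ i) := (hc _ _).1 ⟨1, by simp⟩
          by_cases hi : σ i = k
          · rw [hτ1 i hi, Setoid.ker_def]
            simpa [c', ← hi] using h1
          · rw [hτ2 i hi]
            exact h1
      · intro hij
        cases i with
        | none =>
          cases j with
          | none => exact Equiv.Perm.SameCycle.refl _ _
          | some j => exact hnk.trans (hsome _ _ hij)
        | some i =>
          cases j with
          | none => exact (hsome _ _ hij).trans hnk.symm
          | some j => exact hsome _ _ hij

noncomputable instance fintypeSetoid {ι : Type*} [Finite ι] : Fintype (Setoid ι) := by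
  classical
  have : Finite (Setoid ι) :=
    Finite.of_injective (fun r : Setoid ι => (fun i j => r i j : ι → ι → Prop)) (by
      intro r s h
      ext i j
      exact iff_of_eq (congrFun (congrFun h i) j))
  exact Fintype.ofFinite _

noncomputable def term {ι Q : Type*} [Fintype ι] [Fintype Q] (c : ι → Q) (a : ι → ℤ) :
    MvPolynomial ℤ ℚ :=
  letI := Classical.decEq Q
  (-1 : MvPolynomial ℤ ℚ) ^ (Fintype.card ι + Fintype.card Q) * psi (ptSum c a)

theorem term_equiv {ι Q Q' : Type*} [Fintype ι] [Fintype Q] [Fintype Q'] (e : Q ≃ Q')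
    (c : ι → Q) (a : ι → ℤ) : term c a = term (e ∘ c) a := by
  classical
  unfold term
  rw [Fintype.card_congr e, ← psi_congr e]
  congr 2
  ext q
  simp [ptSum]

noncomputable instance fintypeQuot {ι : Type*} [Finite ι] (r : Setoid ι) :
    Fintype (Quotient r) := Fintype.ofFinite _

theorem term_ker {ι Q : Type*} [Fintype ι] [Fintype Q] (c : ι → Q)
    (hc : Function.Surjective c) (a : ι → ℤ) :
    term (Quotient.mk (Setoid.ker c)) a = term c a :=
  term_equiv (Setoid.quotientKerEquivOfSurjective c hc) _ a

theorem term_ker' {ι Q : Type*} [Fintype ι] [Fintype Q] (r : Setoid ι) (c : ι → Q)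
    (h : r = Setoid.ker c) (hc : Function.Surjective c) (a : ι → ℤ) :
    term (Quotient.mk r) a = term c a := by
  subst h
  exact term_ker c hc a

theorem term_def {ι Q : Type*} [Fintype ι] [Fintype Q] [DecidableEq Q] (c : ι → Q)
    (a : ι → ℤ) : term c a =
    (-1 : MvPolynomial ℤ ℚ) ^ (Fintype.card ι + Fintype.card Q) * psi (ptSum c a) := by
  unfold term
  congr!

noncomputable def G {ι : Type*} [Fintype ι] (a : ι → ℤ) : MvPolynomial ℤ ℚ :=
  ∑ r : Setoid ι, term (Quotient.mk r) a

theorem term_comp {ι κ Q : Type*} [Fintype ι] [Fintype κ] [Fintype Q] (e : ι ≃ κ)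
    (c : κ → Q) (a : κ → ℤ) : term (c ∘ e) (a ∘ e) = term c a := by
  unfold term
  rw [Fintype.card_congr e]
  congr 2
  ext q
  exact ptSum_comp_equiv e c a q

theorem G_equiv {ι κ : Type*} [Fintype ι] [Fintype κ] (e : ι ≃ κ) (a : κ → ℤ) :
    G (a ∘ e) = G a := by
  unfold G
  symm
  refine Fintype.sum_equiv
    (⟨fun r => r.comap e, fun r => r.comap e.symm, ?_, ?_⟩ : Setoid κ ≃ Setoid ι) _ _ ?_
  · intro r; ext i j; simp [Setoid.comap_rel]
  · intro r; ext i j; simp [Setoid.comap_rel]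
  · intro r
    have h : r.comap e = Setoid.ker (Quotient.mk r ∘ e) := by
      ext i j
      simp only [Setoid.comap_rel, Setoid.ker_def, Function.comp]
      exact Iff.symm Quotient.eq
    exact (term_comp e _ a).symm.trans
      (term_ker' _ _ h (Quotient.mk_surjective.comp e.surjective) _).symm

/-- the classifying map of an extension of a setoid to `Option ι` -/
def extMap {ι : Type*} (r : Setoid ι) (o : Option (Quotient r)) :
    Option ι → Option (Quotient r) := fun x => x.elim o (fun i => some (Quotient.mk r i))

theorem ext_bij {ι : Type*} :
    Function.Bijective (fun z : (Σ r : Setoid ι, Option (Quotient r)) =>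
      Setoid.ker (extMap z.1 z.2)) := by
  constructor
  · rintro ⟨r, o⟩ ⟨s, o'⟩ h
    simp only at h
    have h' : ∀ x y, extMap r o x = extMap r o y ↔ extMap s o' x = extMap s o' y := by
      intro x y
      rw [← Setoid.ker_def, h, Setoid.ker_def]
    have hrs : r = s := by
      ext i j
      have := h' (some i) (some j)
      simpa [extMap, Quotient.eq] using this
    subst hrs
    congr 1
    cases o with
    | none =>
      cases o' with
      | none => rfl
      | some q' =>
        obtain ⟨i, rfl⟩ := Quotient.mk_surjective q'
        have := h' none (some i)
        simp [extMap] at this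
    | some q =>
      obtain ⟨i, rfl⟩ := Quotient.mk_surjective q
      have := h' none (some i)
      simp only [extMap, Option.elim, true_iff] at this
      exact this.symm
  · intro s
    by_cases hs : ∃ i, s none (some i)
    · obtain ⟨k, hk⟩ := hs
      refine ⟨⟨s.comap some, some (Quotient.mk _ k)⟩, ?_⟩
      ext x y
      simp only [Setoid.ker_def]
      cases x <;> cases y <;> simp only [extMap, Option.elim, Option.some.injEq, Quotient.eq,
        Setoid.comap_rel, true_iff]
      · exact s.refl _
      · exact ⟨fun h => s.trans hk h, fun h => s.trans (s.symm hk) h⟩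
      · exact ⟨fun h => s.trans h (s.symm hk), fun h => s.trans h hk⟩
    · push Not at hs
      refine ⟨⟨s.comap some, none⟩, ?_⟩
      ext x y
      simp only [Setoid.ker_def]
      cases x <;> cases y <;> simp only [extMap, Option.elim, Option.some.injEq, Quotient.eq,
        Setoid.comap_rel, true_iff, reduceCtorEq, false_iff]
      · exact s.refl _
      · exact hs _
      · exact fun h => hs _ (s.symm h)

theorem G_option {ι : Type*} [Fintype ι] (a : Option ι → ℤ) :
    G a = MvPolynomial.X (a none) * G (fun i => a (some i)) := by
  classical
  unfold G
  rw [← Function.Bijective.sum_comp ext_bij (fun r => term (Quotient.mk r) a),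
    Fintype.sum_sigma, Finset.mul_sum]
  refine Finset.sum_congr rfl fun r _ => ?_
  rw [Fintype.sum_option]
  have h1 : term (Quotient.mk (Setoid.ker (extMap r none))) a = term (extMap r none) a := by
    apply term_ker
    intro q
    cases q with
    | none => exact ⟨none, rfl⟩
    | some q =>
      obtain ⟨i, rfl⟩ := Quotient.mk_surjective q
      exact ⟨some i, rfl⟩
  have h2 : ∀ q, term (Quotient.mk (Setoid.ker (extMap r (some q)))) a =
      term (fun x : Option ι => x.elim q (Quotient.mk r)) a := by
    intro q
    have : Setoid.ker (extMap r (some q)) =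
        Setoid.ker (fun x : Option ι => x.elim q (Quotient.mk r)) := by
      ext x y
      simp only [Setoid.ker_def]
      cases x <;> cases y <;> simp [extMap]
    refine term_ker' _ _ this ?_ a
    intro q
    obtain ⟨i, rfl⟩ := Quotient.mk_surjective q
    exact ⟨some i, rfl⟩
  simp only [h1, h2]
  simp only [term_def]
  rw [psi_option]
  have e1 : ptSum (extMap r none) a none = a none := by
    rw [ptSum_option]
    simp [extMap, ptSum_none]
  have e2 : (fun q => ptSum (extMap r none) a (some q)) =
      ptSum (Quotient.mk r) (fun i => a (some i)) := by
    ext q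
    rw [ptSum_option]
    simp [extMap, ptSum_some]
  have e3 : ∀ q, ptSum (fun x : Option ι => x.elim q (Quotient.mk r)) a =
      fun j => ptSum (Quotient.mk r) (fun i => a (some i)) j + if j = q then a none else 0 := by
    intro q
    ext j
    rw [ptSum_option, add_comm]
    by_cases hq : q = j
    · subst hq
      simp
    · simp [hq, Ne.symm hq]
  have e2' := fun q => congrFun e2 q
  simp only [e1, e2', e3, Fintype.card_option]
  rw [← Finset.mul_sum]
  simp only [pow_add, pow_one]
  ring

theorem G_eq (ι : Type) [Fintype ι] : ∀ a : ι → ℤ, ∏ i, MvPolynomial.X (a i) = G a := by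
  refine Fintype.induction_empty_option
    (P := fun ι _ => ∀ a : ι → ℤ, ∏ i, MvPolynomial.X (a i) = G a) ?_ ?_ ?_ ι
  · intro α β _ e ih a
    letI := Fintype.ofEquiv β e.symm
    rw [← G_equiv e a, ← ih, ← Equiv.prod_comp e]
    rfl
  · intro a
    have : Unique (Setoid PEmpty) := ⟨⟨⊥⟩, fun r => by ext i; exact i.elim⟩
    unfold G
    rw [Fintype.sum_unique]
    have : IsEmpty (Quotient (default : Setoid PEmpty)) := ⟨fun q => by
      obtain ⟨i, _⟩ := Quotient.mk_surjective q
      exact i.elim⟩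
    simp [term, psi]
  · intro α _ ih a
    rw [G_option, ← ih, Fintype.prod_option]

end Helpers

theorem stmt_10 (n : ℕ) (a : Fin n → ℤ) :
    ∏ i, (MvPolynomial.X (a i) : MvPolynomial ℤ ℚ) =
      ∑ p : Finpartition (Finset.univ : Finset (Fin n)),
        (-1 : MvPolynomial ℤ ℚ) ^ (n + p.parts.card) *
          psi (fun b : {b // b ∈ p.parts} => ∑ j ∈ b.1, a j) := by
  classical
  rw [G_eq]
  unfold G
  symm
  have key : Function.Bijective
      (fun p : Finpartition (Finset.univ : Finset (Fin n)) => Setoid.ker p.part) := by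
    constructor
    · intro p q h
      simp only at h
      have hpq : ∀ i, p.part i = q.part i := by
        intro i
        ext j
        rw [p.mem_part_iff_part_eq_part (Finset.mem_univ _) (Finset.mem_univ _),
          q.mem_part_iff_part_eq_part (Finset.mem_univ _) (Finset.mem_univ _),
          ← Setoid.ker_def, h, Setoid.ker_def]
      have hle : ∀ p q : Finpartition (Finset.univ : Finset (Fin n)),
          (∀ i, p.part i = q.part i) → p.parts ⊆ q.parts := by
        intro p q hpq b hb
        obtain ⟨i, hi⟩ := p.nonempty_of_mem_parts hb
        rw [← p.part_eq_of_mem hb hi, hpq]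
        exact q.part_mem.2 (Finset.mem_univ _)
      exact Finpartition.ext (Finset.Subset.antisymm (hle p q hpq)
        (hle q p fun i => (hpq i).symm))
    · intro s
      refine ⟨Finpartition.ofSetoid s, ?_⟩
      ext i j
      rw [Setoid.ker_def, ← Finpartition.mem_part_iff_part_eq_part _ (Finset.mem_univ _)
        (Finset.mem_univ _), Finpartition.mem_part_ofSetoid_iff_rel]
      exact ⟨s.symm, s.symm⟩
  refine Fintype.sum_bijective _ key _ _ ?_
  intro p
  let c : Fin n → {b // b ∈ p.parts} := fun i => ⟨p.part i, p.part_mem.2 (Finset.mem_univ _)⟩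
  have hc : Function.Surjective c := by
    rintro ⟨b, hb⟩
    obtain ⟨i, hi⟩ := p.nonempty_of_mem_parts hb
    exact ⟨i, Subtype.ext (p.part_eq_of_mem hb hi)⟩
  have hk : Setoid.ker p.part = Setoid.ker c := by
    ext i j
    simp [Setoid.ker_def, c]
  rw [term_ker' _ c hk hc, term_def]
  have hx : ptSum c a = fun b : {b // b ∈ p.parts} => ∑ j ∈ b.1, a j := by
    ext ⟨b, hb⟩
    unfold ptSum
    refine Finset.sum_congr ?_ fun _ _ => rfl
    ext i
    simp [c, p.part_eq_iff_mem hb]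
  rw [hx]
  simp only [Fintype.card_fin, Fintype.card_coe]
end

section
/- With λ and N defined as above (λ_A = ∑_{p ∈ SP(A)} (-1)^{|A|+ℓ(p)} M(|p|+𝟙), and for a partition p of a multiset B, N_p := ∏_i N_{p_i}), for every finite multiset B of nonnegative integers with at least 2 elements: ∑_{p ∈ SP(B)} N_p · λ_{|p|} = 0, where |p| is the multiset of block-sums of p and λ_{|p|} is λ applied to that multiset. -/
open Finset

/-- `λ_A := ∑_{p ∈ SP(A)} (-1)^{|A|+ℓ(p)} M(|p|+𝟙)`. -/
def lam {ι : Type*} [Fintype ι] [DecidableEq ι] (a : ι → ℕ) : ℤ :=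
  ∑ p : Finpartition (Finset.univ : Finset ι),
    (-1 : ℤ) ^ (Fintype.card ι + p.parts.card) *
      Nat.multinomial p.parts (fun b => (∑ j ∈ b, a j) + 1)

/-- `N_A := ∑_{r ∈ SP(A)} (-1)^{|A|+ℓ(r)} (ℓ(r)-1)! ∏_j M(r_j+𝟙)`. -/
def bigN {ι : Type*} [Fintype ι] [DecidableEq ι] (a : ι → ℕ) : ℤ :=
  ∑ r : Finpartition (Finset.univ : Finset ι),
    (-1 : ℤ) ^ (Fintype.card ι + r.parts.card) * Nat.factorial (r.parts.card - 1) *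
      ∏ b ∈ r.parts, (Nat.multinomial b (fun j => a j + 1) : ℤ)

namespace KR
variable {α : Type*} [DecidableEq α]

/-- Set partitions of `s` as a finset of finsets of finsets. -/
def SP (s : Finset α) : Finset (Finset (Finset α)) :=
  (univ : Finset (Finpartition s)).image (fun p => p.parts)

lemma mem_SP {s : Finset α} {c : Finset (Finset α)} :
    c ∈ SP s ↔ (∀ b ∈ c, ∀ b' ∈ c, ∀ x, x ∈ b → x ∈ b' → b = b') ∧
      (∀ x, x ∈ s ↔ ∃ b ∈ c, x ∈ b) ∧ ∅ ∉ c := by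
  constructor
  · intro h
    simp only [SP, mem_image, mem_univ, true_and] at h
    obtain ⟨p, rfl⟩ := h
    refine ⟨fun b hb b' hb' x hx hx' => p.eq_of_mem_parts hb hb' hx hx', fun x => ?_, p.bot_notMem⟩
    constructor
    · intro hx
      exact ⟨p.part x, p.part_mem.2 hx, p.mem_part hx⟩
    · rintro ⟨b, hb, hx⟩
      exact p.le hb hx
  · rintro ⟨h1, h2, h3⟩
    simp only [SP, mem_image, mem_univ, true_and]
    refine ⟨⟨c, ?_, ?_, h3⟩, rfl⟩
    · rw [Finset.supIndep_iff_pairwiseDisjoint]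
      intro b hb b' hb' hne
      refine Finset.disjoint_left.2 fun x hx hx' => hne (h1 b hb b' hb' x hx hx')
    · ext x
      rw [h2 x]
      simp [Finset.mem_sup]

lemma sum_SP {M : Type*} [AddCommMonoid M] (s : Finset α) (F : Finset (Finset α) → M) :
    ∑ p : Finpartition s, F p.parts = ∑ c ∈ SP s, F c := by
  rw [SP, Finset.sum_image]
  intro p _ q _ h
  exact Finpartition.ext h

lemma sum_SP_sub {M : Type*} [AddCommMonoid M] (s : Finset α) (F : Finset (Finset α) → M) :
    ∑ p : Finpartition (univ : Finset {x // x ∈ s}),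
      F (p.parts.image (fun b => b.image Subtype.val)) = ∑ c ∈ SP s, F c := by
  rw [sum_SP (univ : Finset {x // x ∈ s}) (fun c => F (c.image (fun b => b.image Subtype.val)))]
  have hinv : ∀ b : Finset {x // x ∈ s}, (b.image Subtype.val).subtype (· ∈ s) = b := by
    intro b; ext x; simp
  refine Finset.sum_bij' (fun c _ => c.image (fun b => b.image Subtype.val))
    (fun c _ => c.image (fun b => b.subtype (· ∈ s))) ?_ ?_ ?_ ?_ ?_
  · intro c hc
    rw [mem_SP] at hc ⊢
    obtain ⟨h1, h2, h3⟩ := hc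
    refine ⟨?_, ?_, ?_⟩
    · intro b hb b' hb' x hx hx'
      simp only [mem_image] at hb hb'
      obtain ⟨d, hd, rfl⟩ := hb
      obtain ⟨d', hd', rfl⟩ := hb'
      simp only [mem_image] at hx hx'
      obtain ⟨y, hy, rfl⟩ := hx
      obtain ⟨y', hy', e⟩ := hx'
      have := Subtype.ext e
      subst this
      rw [h1 d hd d' hd' _ hy hy']
    · intro x
      constructor
      · intro hx
        obtain ⟨b, hb, hxb⟩ := (h2 ⟨x, hx⟩).1 (mem_univ _)
        exact ⟨_, mem_image_of_mem _ hb, mem_image.2 ⟨_, hxb, rfl⟩⟩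
      · rintro ⟨b, hb, hx⟩
        obtain ⟨d, hd, rfl⟩ := mem_image.1 hb
        obtain ⟨y, hy, rfl⟩ := mem_image.1 hx
        exact y.2
    · intro h
      obtain ⟨d, hd, e⟩ := mem_image.1 h
      rw [Finset.image_eq_empty] at e
      exact h3 (e ▸ hd)
  · intro c hc
    rw [mem_SP] at hc ⊢
    obtain ⟨h1, h2, h3⟩ := hc
    refine ⟨?_, ?_, ?_⟩
    · intro b hb b' hb' x hx hx'
      obtain ⟨d, hd, rfl⟩ := mem_image.1 hb
      obtain ⟨d', hd', rfl⟩ := mem_image.1 hb'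
      rw [h1 d hd d' hd' x.1 (by simpa using hx) (by simpa using hx')]
    · intro x
      simp only [mem_univ, true_iff]
      obtain ⟨b, hb, hxb⟩ := (h2 x.1).1 x.2
      exact ⟨_, mem_image_of_mem _ hb, by simpa using hxb⟩
    · intro h
      obtain ⟨d, hd, e⟩ := mem_image.1 h
      obtain rfl | ⟨x, hx⟩ := d.eq_empty_or_nonempty
      · exact h3 hd
      · have hxs : x ∈ s := (h2 x).2 ⟨d, hd, hx⟩
        have : (⟨x, hxs⟩ : {x // x ∈ s}) ∈ d.subtype (· ∈ s) := by simpa using hx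
        rw [e] at this
        simp at this
  · intro c hc
    simp only [image_image]
    ext b
    simp [Function.comp_def, hinv]
  · intro c hc
    rw [mem_SP] at hc
    obtain ⟨h1, h2, h3⟩ := hc
    simp only [image_image]
    have : ∀ d ∈ c, ((fun b : Finset {x // x ∈ s} => b.image Subtype.val) ∘
      (fun b => b.subtype (· ∈ s))) d = d := by
      intro d hd
      ext x
      simp only [Function.comp, mem_image, mem_subtype, Subtype.exists, exists_and_left,
        exists_prop, exists_eq_right_right, and_iff_left_iff_imp]
      intro hx
      exact (h2 x).2 ⟨d, hd, hx⟩
    rw [Finset.image_congr (g := id) (fun d hd => this d hd)]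
    simp
  · intro c hc; rfl

lemma SP_empty : SP (∅ : Finset α) = {∅} := by
  ext c
  rw [mem_SP, mem_singleton]
  constructor
  · rintro ⟨h1, h2, h3⟩
    rw [Finset.eq_empty_iff_forall_notMem]
    intro b hb
    obtain rfl | ⟨x, hx⟩ := b.eq_empty_or_nonempty
    · exact h3 hb
    · simpa using (h2 x).2 ⟨b, hb, hx⟩
  · rintro rfl
    simp

/-- Splitting a partition into two sub-families. -/
lemma sum_split {M : Type*} [AddCommMonoid M] (C : Finset α)
    (G : Finset (Finset α) → Finset (Finset α) → M) :
    ∑ p ∈ SP C, ∑ c ∈ p.powerset, G c (p \ c) =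
      ∑ D ∈ C.powerset, ∑ p1 ∈ SP D, ∑ p2 ∈ SP (C \ D), G p1 p2 := by
  simp_rw [Finset.sum_sigma']
  refine Finset.sum_bij' (fun x _ => ⟨x.2.sup id, x.2, x.1 \ x.2⟩)
    (fun y _ => ⟨y.2.1 ∪ y.2.2, y.2.1⟩) ?_ ?_ ?_ ?_ ?_
  · rintro ⟨p, c⟩ h
    simp only [mem_sigma, mem_powerset, mem_SP] at h ⊢
    obtain ⟨⟨h1, h2, h3⟩, hc⟩ := h
    refine ⟨?_, ⟨?_, ?_, ?_⟩, ?_, ?_, ?_⟩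
    · intro x hx
      simp only [mem_sup, id] at hx
      obtain ⟨b, hb, hx⟩ := hx
      exact (h2 x).2 ⟨b, hc hb, hx⟩
    · exact fun b hb b' hb' => h1 b (hc hb) b' (hc hb')
    · intro x; simp [mem_sup]
    · exact fun h => h3 (hc h)
    · intro b hb b' hb'
      exact h1 b (mem_sdiff.1 hb).1 b' (mem_sdiff.1 hb').1
    · intro x
      simp only [mem_sdiff, mem_sup, id, h2 x]
      constructor
      · rintro ⟨⟨b, hb, hx⟩, hn⟩
        exact ⟨b, ⟨hb, fun h => hn ⟨b, h, hx⟩⟩, hx⟩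
      · rintro ⟨b, ⟨hb, hbc⟩, hx⟩
        refine ⟨⟨b, hb, hx⟩, ?_⟩
        rintro ⟨b', hb', hx'⟩
        exact hbc (h1 b hb b' (hc hb') x hx hx' ▸ hb')
    · exact fun h => h3 (mem_sdiff.1 h).1
  · rintro ⟨D, p1, p2⟩ h
    simp only [mem_sigma, mem_powerset, mem_SP] at h ⊢
    obtain ⟨hD, ⟨h1, h2, h3⟩, k1, k2, k3⟩ := h
    refine ⟨⟨?_, ?_, ?_⟩, subset_union_left⟩
    · intro b hb b' hb' x hx hx'
      rcases mem_union.1 hb with hb | hb <;> rcases mem_union.1 hb' with hb' | hb'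
      · exact h1 b hb b' hb' x hx hx'
      · exact absurd ((h2 x).2 ⟨b, hb, hx⟩) (mem_sdiff.1 ((k2 x).2 ⟨b', hb', hx'⟩)).2
      · exact absurd ((h2 x).2 ⟨b', hb', hx'⟩) (mem_sdiff.1 ((k2 x).2 ⟨b, hb, hx⟩)).2
      · exact k1 b hb b' hb' x hx hx'
    · intro x
      constructor
      · intro hx
        by_cases hxD : x ∈ D
        · obtain ⟨b, hb, hh⟩ := (h2 x).1 hxD
          exact ⟨b, mem_union_left _ hb, hh⟩
        · obtain ⟨b, hb, hh⟩ := (k2 x).1 (mem_sdiff.2 ⟨hx, hxD⟩)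
          exact ⟨b, mem_union_right _ hb, hh⟩
      · rintro ⟨b, hb, hx⟩
        rcases mem_union.1 hb with hb | hb
        · exact hD ((h2 x).2 ⟨b, hb, hx⟩)
        · exact (mem_sdiff.1 ((k2 x).2 ⟨b, hb, hx⟩)).1
    · intro h
      rcases mem_union.1 h with hb | hb
      · exact h3 hb
      · exact k3 hb
  · rintro ⟨p, c⟩ h
    simp only [mem_sigma, mem_powerset] at h ⊢
    simp [Finset.union_sdiff_of_subset h.2]
  · rintro ⟨D, p1, p2⟩ h
    simp only [mem_sigma, mem_powerset, mem_SP] at h ⊢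
    obtain ⟨hD, ⟨h1, h2, h3⟩, k1, k2, k3⟩ := h
    have e1 : p1.sup id = D := by
      ext x; rw [h2 x]; simp [mem_sup]
    have e2 : (p1 ∪ p2) \ p1 = p2 := by
      rw [Finset.union_sdiff_left, Finset.sdiff_eq_self_iff_disjoint, Finset.disjoint_left]
      intro b hb2 hb1
      obtain rfl | ⟨x, hx⟩ := b.eq_empty_or_nonempty
      · exact h3 hb1
      · exact (mem_sdiff.1 ((k2 x).2 ⟨b, hb2, hx⟩)).2 ((h2 x).2 ⟨b, hb1, hx⟩)
    subst e1
    simp only [e2]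
  · rintro ⟨p, c⟩ h
    rfl

lemma singleton_SP {D : Finset α} (h : D.Nonempty) : {D} ∈ SP D := by
  rw [mem_SP]
  refine ⟨by simp +contextual, by simp, ?_⟩
  simp only [mem_singleton]
  exact fun e => h.ne_empty e.symm

lemma sup_of_SP {D : Finset α} {p : Finset (Finset α)} (h : p ∈ SP D) : p.sup id = D := by
  rw [mem_SP] at h
  ext x; rw [h.2.1 x]; simp [mem_sup]

lemma eq_singleton_of_SP {D : Finset α} {p : Finset (Finset α)} (h : p ∈ SP D) (hc : p.card = 1) :
    p = {D} := by
  obtain ⟨b, rfl⟩ := Finset.card_eq_one.1 hc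
  have := sup_of_SP h
  simp at this
  rw [this]

/-- Marking a block. -/
lemma sum_mark {M : Type*} [AddCommMonoid M] (C : Finset α)
    (G : Finset α → Finset (Finset α) → M) :
    ∑ p ∈ SP C, ∑ D ∈ p, G D (p.erase D) =
      ∑ D ∈ C.powerset with D.Nonempty, ∑ p2 ∈ SP (C \ D), G D p2 := by
  have h := sum_split C (fun c d => if c.card = 1 then G (c.sup id) d else 0)
  have hl : ∀ p ∈ SP C, ∑ D ∈ p, G D (p.erase D) =
      ∑ c ∈ p.powerset, (if c.card = 1 then G (c.sup id) (p \ c) else 0) := by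
    intro p hp
    rw [← Finset.sum_filter]
    refine Finset.sum_bij' (fun D _ => {D}) (fun c _ => c.sup id) ?_ ?_ ?_ ?_ ?_
    · intro D hD; simpa using hD
    · intro c hc
      obtain ⟨hc, h1⟩ := mem_filter.1 hc
      obtain ⟨b, rfl⟩ := Finset.card_eq_one.1 h1
      simpa using hc
    · intro D hD; simp
    · intro c hc
      obtain ⟨hc, h1⟩ := mem_filter.1 hc
      obtain ⟨b, rfl⟩ := Finset.card_eq_one.1 h1
      simp
    · intro D hD; simp [Finset.sdiff_singleton_eq_erase]
  rw [Finset.sum_congr rfl hl, h, Finset.sum_filter]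
  refine Finset.sum_congr rfl fun D hD => ?_
  split_ifs with hne
  · rw [Finset.sum_eq_single {D}]
    · simp
    · intro p hp hpD
      have : p.card ≠ 1 := fun hc => hpD (eq_singleton_of_SP hp hc)
      simp [this]
    · intro h; exact absurd (singleton_SP hne) h
  · rw [Finset.not_nonempty_iff_eq_empty] at hne
    subst hne
    simp [SP_empty]

/-- Recursion on the block containing `i`. -/
lemma sum_rec (C : Finset α) (i : α) (hi : i ∈ C) (h : ℕ → ℚ) (f : Finset α → ℚ) :
    ∑ p ∈ SP C, h p.card * ∏ b ∈ p, f b =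
      ∑ D ∈ C.powerset with i ∈ D, f D * ∑ p ∈ SP (C \ D), h (p.card + 1) * ∏ b ∈ p, f b := by
  have key := sum_mark C (fun D p => if i ∈ D then f D * (h (p.card + 1) * ∏ b ∈ p, f b) else 0)
  have hl : ∀ p ∈ SP C, h p.card * ∏ b ∈ p, f b = ∑ D ∈ p,
      (if i ∈ D then f D * (h ((p.erase D).card + 1) * ∏ b ∈ p.erase D, f b) else 0) := by
    intro p hp
    rw [mem_SP] at hp
    obtain ⟨b, hb, hib⟩ := (hp.2.1 i).1 hi
    rw [Finset.sum_eq_single b]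
    · rw [if_pos hib, Finset.card_erase_add_one hb, ← Finset.mul_prod_erase _ _ hb]
      ring
    · intro b' hb' hne
      rw [if_neg]
      exact fun h => hne (hp.1 b' hb' b hb i h hib)
    · intro h; exact absurd hb h
  rw [Finset.sum_congr rfl hl, key, Finset.sum_filter, Finset.sum_filter]
  refine Finset.sum_congr rfl fun D hD => ?_
  by_cases hiD : i ∈ D
  · rw [if_pos ⟨i, hiD⟩, if_pos hiD, Finset.mul_sum]
    simp [hiD]
  · simp [hiD]

/-- Chains of two partitions. -/
lemma chain (n : Finset α → ℚ) (g : Finset (Finset α) → ℚ) :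
    ∀ (k : ℕ) (C : Finset α), C.card = k → ∀ h : ℕ → ℚ,
    ∑ p ∈ SP C, (∏ b ∈ p, n b) * ∑ q ∈ SP p, h q.card * ∏ c ∈ q, g c =
      ∑ q ∈ SP C, h q.card * ∏ D ∈ q, ∑ p ∈ SP D, g p * ∏ b ∈ p, n b := by
  intro k
  induction k using Nat.strong_induction_on with
  | _ k ih =>
  intro C hC h
  obtain rfl | ⟨i, hi⟩ := C.eq_empty_or_nonempty
  · simp [SP_empty]
  rw [sum_rec C i hi h (fun D => ∑ p ∈ SP D, g p * ∏ b ∈ p, n b)]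
  obtain ⟨G, hG⟩ : ∃ G : Finset (Finset α) → Finset (Finset α) → ℚ, G = (fun c d => if i ∈ c.sup id then
        (g c * ∏ b ∈ c, n b) * ((∏ b ∈ d, n b) * ∑ q ∈ SP d, h (q.card + 1) * ∏ c ∈ q, g c)
        else 0) := ⟨_, rfl⟩
  have hl : ∀ p ∈ SP C, (∏ b ∈ p, n b) * ∑ q ∈ SP p, h q.card * ∏ c ∈ q, g c =
      ∑ c ∈ p.powerset, G c (p \ c) := by
    intro p hp
    rw [mem_SP] at hp
    obtain ⟨b, hb, hib⟩ := (hp.2.1 i).1 hi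
    rw [sum_rec p b hb h g, Finset.mul_sum, Finset.sum_filter]
    refine Finset.sum_congr rfl fun c hc => ?_
    have hcp := mem_powerset.1 hc
    have hiff : b ∈ c ↔ i ∈ c.sup id := by
      simp only [mem_sup, id]
      constructor
      · intro h; exact ⟨b, h, hib⟩
      · rintro ⟨b', hb', hi'⟩
        exact hp.1 b hb b' (hcp hb') i hib hi' ▸ hb'
    simp only [hiff, hG]
    split_ifs
    · rw [← Finset.prod_sdiff hcp]; ring
    · rfl
  rw [Finset.sum_congr rfl hl, sum_split, Finset.sum_filter]
  simp only [hG]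
  refine Finset.sum_congr rfl fun D hD => ?_
  have hDC := mem_powerset.1 hD
  have : ∀ p1 ∈ SP D, i ∈ p1.sup id ↔ i ∈ D := fun p1 h1 => by rw [sup_of_SP h1]
  split_ifs with hiD
  · rw [← ih (C \ D).card _ (C \ D) rfl (fun l => h (l+1)), Finset.sum_mul]
    · refine Finset.sum_congr rfl fun p1 h1 => ?_
      rw [Finset.mul_sum]
      refine Finset.sum_congr rfl fun p2 h2 => ?_
      rw [if_pos ((this p1 h1).2 hiD)]
    · rw [← hC]
      refine Finset.card_lt_card ?_
      refine ⟨sdiff_subset, fun h => ?_⟩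
      exact (mem_sdiff.1 (h hi)).2 hiD
  · refine Finset.sum_eq_zero fun p1 h1 => Finset.sum_eq_zero fun p2 h2 => ?_
    rw [if_neg (fun h => hiD ((this p1 h1).1 h))]

/-- Signed sum over cycle types. -/
lemma esum : ∀ (k : ℕ) (C : Finset α), C.card = k →
    ∑ p ∈ SP C, ∏ b ∈ p, (-((b.card - 1).factorial : ℚ)) =
      if k = 0 then 1 else if k = 1 then -1 else 0 := by
  intro k
  induction k using Nat.strong_induction_on with
  | _ k ih =>
  intro C hC
  obtain rfl | ⟨i, hi⟩ := C.eq_empty_or_nonempty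
  · simp at hC; subst hC; simp [SP_empty]
  have hrec := sum_rec C i hi (fun _ => 1) (fun b => -((b.card - 1).factorial : ℚ))
  simp only [one_mul] at hrec
  rw [hrec]
  have hkpos : 0 < k := by rw [← hC]; exact card_pos.2 ⟨i, hi⟩
  have hs : ∀ D ∈ C.powerset.filter (i ∈ ·), (-((D.card - 1).factorial : ℚ)) *
      ∑ p ∈ SP (C \ D), ∏ b ∈ p, (-((b.card - 1).factorial : ℚ)) =
      (if D = C then -((k-1).factorial : ℚ) else 0) +
        ∑ j ∈ C.erase i, if D = C.erase j then ((k-2).factorial : ℚ) else 0 := by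
    intro D hD
    obtain ⟨hDC, hiD⟩ := mem_filter.1 hD
    rw [mem_powerset] at hDC
    have hcard : (C \ D).card = k - D.card := by rw [card_sdiff_of_subset hDC, hC]
    have hle : D.card ≤ k := hC ▸ card_le_card hDC
    have hDpos : 0 < D.card := card_pos.2 ⟨i, hiD⟩
    rw [ih (C \ D).card (by omega) (C \ D) rfl]
    by_cases hE : D = C
    · subst hE
      have : ∀ j ∈ D.erase i, (if D = D.erase j then ((k-2).factorial : ℚ) else 0) = 0 := by
        intro j hj
        rw [if_neg]
        intro h
        exact (Finset.notMem_erase j D) (h ▸ (mem_erase.1 hj).2)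
      rw [Finset.sum_eq_zero this]
      simp [hC]
    · have h0 : (C \ D).card ≠ 0 := by
        intro h
        rw [card_eq_zero, sdiff_eq_empty_iff_subset] at h
        exact hE (Finset.Subset.antisymm hDC h)
      rw [if_neg h0, if_neg hE]
      by_cases h1 : (C \ D).card = 1
      · obtain ⟨j, hj⟩ := card_eq_one.1 h1
        have hjm : j ∈ C \ D := by rw [hj]; simp
        have hDj : D = C.erase j := by
          rw [← sdiff_singleton_eq_erase, ← hj, Finset.sdiff_sdiff_eq_self hDC]
        have hji : j ≠ i := by rintro rfl; exact (mem_sdiff.1 hjm).2 hiD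
        rw [Finset.sum_eq_single j]
        · rw [if_pos h1, if_pos hDj, show D.card - 1 = k - 2 by omega]; simp
        · intro j' hj' hne
          rw [if_neg]
          intro h
          have : j' ∈ C \ D := mem_sdiff.2 ⟨(mem_erase.1 hj').2, by rw [h]; simp⟩
          rw [hj] at this
          exact hne (mem_singleton.1 this)
        · intro h; exact absurd (mem_erase.2 ⟨hji, (mem_sdiff.1 hjm).1⟩) h
      · rw [if_neg h1, Finset.sum_eq_zero]
        · simp
        · intro j hj
          rw [if_neg]
          rintro h
          have hjC := (mem_erase.1 hj).2
          have : D.card = k - 1 := by rw [h, card_erase_of_mem hjC, hC]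
          omega
  rw [Finset.sum_congr rfl hs, Finset.sum_add_distrib, Finset.sum_ite_eq', if_pos (by simp [hi]),
    Finset.sum_comm]
  have : ∀ j ∈ C.erase i, (∑ D ∈ C.powerset with i ∈ D,
      if D = C.erase j then ((k-2).factorial : ℚ) else 0) = (k-2).factorial := by
    intro j hj
    rw [Finset.sum_ite_eq', if_pos]
    simp only [mem_filter, mem_powerset, erase_subset, true_and, mem_erase]
    exact ⟨(ne_of_mem_erase hj).symm, hi⟩
  rw [Finset.sum_congr rfl this, Finset.sum_const, card_erase_of_mem hi, hC]
  rw [if_neg hkpos.ne']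
  split_ifs with h1
  · subst h1; simp
  · obtain ⟨m, rfl⟩ : ∃ m, k = m + 2 := ⟨k - 2, by omega⟩
    simp [Nat.factorial_succ]

/-- The polynomials of (multivariate Rothe) binomial type. -/
def P (a : α → ℕ) (D : Finset α) (x : ℤ) : ℚ :=
  if D.card = 0 then 1 else
    (x : ℚ) * ∏ j ∈ range (D.card - 1), ((x : ℚ) + ((∑ i ∈ D, a i : ℕ) : ℚ) + 1 + (j : ℚ))

lemma P_diff (a : α → ℕ) (C : Finset α) (x : ℤ) :
    P a C (x + 1) - P a C x = ∑ i ∈ C, P a (C.erase i) (x + 1 + a i) := by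
  rcases hk : C.card with _ | _ | m
  · rw [card_eq_zero] at hk; subst hk; simp [P]
  · obtain ⟨i, rfl⟩ := card_eq_one.1 hk
    simp [P]
  · set w : ℚ := ((∑ i ∈ C, a i : ℕ) : ℚ) with hw
    have hr : ∀ i ∈ C, P a (C.erase i) (x + 1 + a i) =
        ((x : ℚ) + 1 + a i) * ∏ j ∈ range m, ((x : ℚ) + w + 2 + j) := by
      intro i hi
      have hc : (C.erase i).card = m + 1 := by rw [card_erase_of_mem hi, hk]; rfl
      have hwi : w = (a i : ℚ) + ((∑ i ∈ C.erase i, a i : ℕ) : ℚ) := by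
        rw [hw, ← Finset.add_sum_erase _ _ hi]; push_cast; rfl
      rw [P, hc, if_neg (by omega), hwi]
      push_cast
      congr 1
      refine Finset.prod_congr rfl fun j _ => ?_
      ring
    rw [Finset.sum_congr rfl hr, ← Finset.sum_mul, Finset.sum_add_distrib, Finset.sum_const, hk]
    have hw' : ∑ i ∈ C, (a i : ℚ) = w := by rw [hw]; push_cast; rfl
    rw [hw']
    have e1 : P a C (x + 1) = ((x : ℚ) + 1) * ((∏ j ∈ range m, ((x : ℚ) + w + 2 + j)) *
        ((x : ℚ) + w + 2 + m)) := by
      rw [P, hk, if_neg (by omega), ← Finset.prod_range_succ (fun j => (x : ℚ) + w + 2 + j)]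
      push_cast
      congr 1
      refine Finset.prod_congr rfl fun j _ => ?_
      rw [hw]; push_cast; ring
    have e2 : P a C x = (x : ℚ) * ((∏ j ∈ range m, ((x : ℚ) + w + 2 + j)) *
        ((x : ℚ) + w + 1)) := by
      rw [P, hk, if_neg (by omega), show m + 1 + 1 - 1 = m + 1 from rfl, Finset.prod_range_succ']
      congr 2
      · refine Finset.prod_congr rfl fun j _ => ?_
        rw [hw]; push_cast; ring
      · simp [hw]
    rw [e1, e2, nsmul_eq_mul]
    push_cast
    ring

lemma int_ext (f g : ℤ → ℚ) (h0 : f 0 = g 0)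
    (h : ∀ x, f (x + 1) - f x = g (x + 1) - g x) : ∀ x, f x = g x := by
  intro x
  induction x using Int.induction_on with
  | zero => exact h0
  | succ i ih => have := h i; linarith
  | pred i ih =>
    have := h (-(i:ℤ) - 1)
    rw [sub_add_cancel] at this
    linarith

lemma P_zero (a : α → ℕ) (C : Finset α) : P a C 0 = if C = ∅ then 1 else 0 := by
  simp [P]

lemma P_empty (a : α → ℕ) (x : ℤ) : P a ∅ x = 1 := by
  simp [P]

lemma P_conv (a : α → ℕ) : ∀ (k : ℕ) (C : Finset α), C.card = k → ∀ x y : ℤ,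
    ∑ D ∈ C.powerset, P a D x * P a (C \ D) y = P a C (x + y) := by
  intro k
  induction k with
  | zero =>
    intro C hC x y
    rw [card_eq_zero] at hC; subst hC; simp [P]
  | succ k ih =>
    intro C hC x y
    refine int_ext (fun x => ∑ D ∈ C.powerset, P a D x * P a (C \ D) y)
      (fun x => P a C (x + y)) ?_ ?_ x
    · simp only [P_zero, zero_add]
      rw [Finset.sum_eq_single ∅]
      · simp
      · intro D _ hD; simp [hD]
      · intro h; simp at h
    · intro x
      rw [← Finset.sum_sub_distrib]
      simp only [← sub_mul, P_diff]
      rw [show x + 1 + y = x + y + 1 by ring, P_diff]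
      simp only [Finset.sum_mul]
      rw [Finset.sum_comm' (t' := C) (s' := fun i => C.powerset.filter (i ∈ ·))]
      · refine Finset.sum_congr rfl fun i hi => ?_
        rw [show x + y + 1 + (a i : ℤ) = (x + 1 + a i) + y by ring,
          ← ih (C.erase i) (by rw [card_erase_of_mem hi, hC]; rfl)]
        refine Finset.sum_bij' (fun D _ => D.erase i) (fun D _ => insert i D) ?_ ?_ ?_ ?_ ?_
        · intro D hD
          simp only [mem_filter, mem_powerset] at hD ⊢
          exact Finset.erase_subset_erase _ hD.1
        · intro D hD
          simp only [mem_filter, mem_powerset] at hD ⊢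
          exact ⟨Finset.insert_subset hi (hD.trans (erase_subset _ _)), mem_insert_self _ _⟩
        · intro D hD
          exact Finset.insert_erase (mem_filter.1 hD).2
        · intro D hD
          refine Finset.erase_insert fun h => ?_
          exact Finset.notMem_erase i C ((mem_powerset.1 hD) h)
        · intro D hD
          have hiD := (mem_filter.1 hD).2
          have : C.erase i \ D.erase i = C \ D := by
            ext z
            simp only [mem_sdiff, mem_erase]
            constructor
            · rintro ⟨⟨h1, h2⟩, h3⟩; exact ⟨h2, fun h => h3 ⟨h1, h⟩⟩
            · rintro ⟨h1, h2⟩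
              exact ⟨⟨fun h => h2 (h ▸ hiD), h1⟩, fun h => h2 h.2⟩
          rw [this]
      · intro D i
        simp only [mem_powerset, mem_filter]
        constructor
        · rintro ⟨h1, h2⟩; exact ⟨⟨h1, h2⟩, h1 h2⟩
        · rintro ⟨h, _⟩; exact h

/-- Falling factorial. -/
def ff (x : ℤ) (l : ℕ) : ℚ := ∏ j ∈ range l, ((x : ℚ) - j)

lemma ff_diff (x : ℤ) (l : ℕ) : ff (x + 1) (l + 1) - ff x (l + 1) = (l + 1) * ff x l := by
  have e1 : ff (x + 1) (l + 1) = ff x l * (x + 1) := by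
    rw [ff, Finset.prod_range_succ', ff]
    push_cast
    congr 1
    · refine Finset.prod_congr rfl fun j _ => ?_
      ring
    · ring
  have e2 : ff x (l + 1) = ff x l * (x - l) := by
    rw [ff, Finset.prod_range_succ, ← ff]
  rw [e1, e2]
  ring

lemma T_eq (a : α → ℕ) : ∀ (k : ℕ) (C : Finset α), C.card = k → ∀ x : ℤ,
    ∑ p ∈ SP C, ff x p.card * ∏ b ∈ p, P a b 1 = P a C x := by
  intro k
  induction k using Nat.strong_induction_on with
  | _ k ih =>
  intro C hC x
  obtain rfl | hne := C.eq_empty_or_nonempty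
  · simp [SP_empty, ff, P]
  refine int_ext (fun x => ∑ p ∈ SP C, ff x p.card * ∏ b ∈ p, P a b 1) (fun x => P a C x) ?_ ?_ x
  · simp only [P_zero, if_neg hne.ne_empty]
    refine Finset.sum_eq_zero fun p hp => ?_
    have : p.card ≠ 0 := by
      intro h
      rw [card_eq_zero] at h
      have := sup_of_SP hp
      rw [h] at this
      exact hne.ne_empty this.symm
    obtain ⟨m, hm⟩ := Nat.exists_eq_succ_of_ne_zero this
    rw [hm, ff, Finset.prod_range_succ']
    simp
  · intro x
    rw [← Finset.sum_sub_distrib]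
    have hl : ∀ p ∈ SP C, ff (x + 1) p.card * ∏ b ∈ p, P a b 1 - ff x p.card * ∏ b ∈ p, P a b 1 =
        ∑ D ∈ p, P a D 1 * (ff x (p.erase D).card * ∏ b ∈ p.erase D, P a b 1) := by
      intro p hp
      have : ∀ D ∈ p, P a D 1 * (ff x (p.erase D).card * ∏ b ∈ p.erase D, P a b 1) =
          ff x (p.card - 1) * ∏ b ∈ p, P a b 1 := by
        intro D hD
        rw [card_erase_of_mem hD, ← Finset.mul_prod_erase _ _ hD]; ring
      rw [Finset.sum_congr rfl this, Finset.sum_const, ← sub_mul, nsmul_eq_mul]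
      rcases p.card with _ | m
      · simp [ff]
      · rw [ff_diff]; push_cast; ring
    rw [Finset.sum_congr rfl hl,
      sum_mark C (fun D p => P a D 1 * (ff x p.card * ∏ b ∈ p, P a b 1))]
    rw [add_comm x 1, ← P_conv a C.card C rfl 1 x,
      ← Finset.sum_filter_add_sum_filter_not C.powerset (fun D => D.Nonempty)]
    have hemp : ∑ D ∈ C.powerset with ¬ D.Nonempty, P a D 1 * P a (C \ D) x = P a C x := by
      rw [Finset.sum_eq_single ∅]
      · simp [P_empty]
      · intro D hD hD'
        exact absurd (Finset.not_nonempty_iff_eq_empty.1 (mem_filter.1 hD).2) hD'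
      · intro h; simp at h
    rw [hemp, add_sub_cancel_right]
    refine Finset.sum_congr rfl fun D hD => ?_
    obtain ⟨hDC, i, hi⟩ := mem_filter.1 hD
    rw [mem_powerset] at hDC
    rw [← Finset.mul_sum, ih (C \ D).card _ (C \ D) rfl]
    rw [← hC]
    exact Finset.card_lt_card ⟨sdiff_subset, fun h => (mem_sdiff.1 (h (hDC hi))).2 hi⟩

lemma ff_neg (W l : ℕ) : (W.factorial : ℚ) * ff (-((W : ℤ) + 1)) l = (-1) ^ l * (W + l).factorial := by
  induction l with
  | zero => simp [ff]
  | succ l ih =>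
    rw [ff, Finset.prod_range_succ, ← ff, ← mul_assoc, ih, ← add_assoc, Nat.factorial_succ]
    push_cast
    ring

lemma P_neg (a : α → ℕ) (C : Finset α) (h : 2 ≤ C.card) :
    P a C (-(((∑ i ∈ C, a i : ℕ) : ℤ) + 1)) = 0 := by
  obtain ⟨m, hm⟩ : ∃ m, C.card = m + 2 := ⟨C.card - 2, by omega⟩
  rw [P, hm, if_neg (by omega), show m + 2 - 1 = m + 1 from rfl, Finset.prod_range_succ']
  push_cast
  ring

lemma P_one (a : α → ℕ) (D : Finset α) (h : D.Nonempty) :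
    P a D 1 * ((∑ i ∈ D, a i) + 1).factorial = ((∑ i ∈ D, a i) + D.card).factorial := by
  obtain ⟨m, hm⟩ : ∃ m, D.card = m + 1 := ⟨D.card - 1, by have := card_pos.2 h; omega⟩
  rw [P, hm, if_neg (by omega), Nat.add_sub_cancel]
  generalize ∑ i ∈ D, a i = w
  clear hm
  induction m with
  | zero => simp
  | succ m ih =>
    rw [Finset.prod_range_succ, ← add_assoc, Nat.factorial_succ (w + (m + 1)), Nat.cast_mul, ← ih]
    push_cast
    ring

/-- The rational version of `bigN`. -/
def NN (a : α → ℕ) (b : Finset α) : ℤ :=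
  ∑ r ∈ SP b, (-1 : ℤ) ^ (b.card + r.card) * Nat.factorial (r.card - 1) *
      ∏ c ∈ r, (Nat.multinomial c (fun j => a j + 1) : ℤ)

lemma card_of_SP {D : Finset α} {p : Finset (Finset α)} (h : p ∈ SP D) : ∑ b ∈ p, b.card = D.card := by
  obtain ⟨q, -, rfl⟩ := mem_image.1 h
  exact q.sum_card_parts

lemma sum_of_SP {M : Type*} [AddCommMonoid M] {D : Finset α} {p : Finset (Finset α)} (h : p ∈ SP D)
    (f : α → M) : ∑ b ∈ p, ∑ i ∈ b, f i = ∑ i ∈ D, f i := by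
  have h' := mem_SP.1 h
  have := sup_of_SP h
  rw [← this, Finset.sup_eq_biUnion, Finset.sum_biUnion]
  · rfl
  · intro b hb b' hb' hne
    refine Finset.disjoint_left.2 fun x hx hx' => hne (h'.1 b hb b' hb' x hx hx')

lemma prod_of_SP {M : Type*} [CommMonoid M] {D : Finset α} {p : Finset (Finset α)} (h : p ∈ SP D)
    (f : α → M) : ∏ b ∈ p, ∏ i ∈ b, f i = ∏ i ∈ D, f i :=
  sum_of_SP (M := Additive M) h f

lemma multinomial_q {β : Type*} (s : Finset β) (f : β → ℕ) : (Nat.multinomial s f : ℚ) =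
    ((∑ i ∈ s, f i).factorial : ℚ) * ∏ i ∈ s, ((f i).factorial : ℚ)⁻¹ := by
  have := Nat.multinomial_spec s f
  have h2 : (∏ i ∈ s, ((f i).factorial : ℚ)) ≠ 0 :=
    Finset.prod_ne_zero_iff.2 fun i _ => by exact_mod_cast Nat.factorial_ne_zero _
  rw [Finset.prod_inv_distrib, ← this]
  push_cast
  field_simp

lemma nonempty_of_mem_SP {C : Finset α} {p : Finset (Finset α)} (h : p ∈ SP C) {b : Finset α}
    (hb : b ∈ p) : b.Nonempty := by
  rw [Finset.nonempty_iff_ne_empty]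
  rintro rfl
  exact (mem_SP.1 h).2.2 hb

lemma F_eq (a : α → ℕ) (D : Finset α) (hD : D.Nonempty) :
    ∑ p ∈ SP D, (-1 : ℚ) ^ p.card * ∏ b ∈ p, (NN a b : ℚ) =
      (-1) ^ D.card * Nat.multinomial D (fun j => a j + 1) := by
  have hN : ∀ b, (NN a b : ℚ) = ∑ r ∈ SP b, ((-1) ^ r.card * ((r.card - 1).factorial : ℚ)) *
      ∏ c ∈ r, ((-1) ^ c.card * (Nat.multinomial c (fun j => a j + 1) : ℚ)) := by
    intro b
    rw [NN]
    push_cast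
    refine Finset.sum_congr rfl fun r hr => ?_
    rw [Finset.prod_mul_distrib, Finset.prod_pow_eq_pow_sum, card_of_SP hr, pow_add]
    ring
  simp only [hN]
  rw [← chain _ (fun r => (-1) ^ r.card * ((r.card - 1).factorial : ℚ)) D.card D rfl
    (fun l => (-1) ^ l)]
  have hin : ∀ p ∈ SP D, ∑ q ∈ SP p, (-1 : ℚ) ^ q.card *
      ∏ c ∈ q, ((-1) ^ c.card * ((c.card - 1).factorial : ℚ)) =
      if p = {D} then 1 else 0 := by
    intro p hp
    have h1 : ∀ q ∈ SP p, (-1 : ℚ) ^ q.card *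
      ∏ c ∈ q, ((-1) ^ c.card * ((c.card - 1).factorial : ℚ)) =
        (-1) ^ p.card * ∏ c ∈ q, (-((c.card - 1).factorial : ℚ)) := by
      intro q hq
      rw [Finset.prod_mul_distrib, Finset.prod_pow_eq_pow_sum, card_of_SP hq, Finset.prod_neg]
      ring
    rw [Finset.sum_congr rfl h1, ← Finset.mul_sum, esum p.card p rfl]
    have h0 : p.card ≠ 0 := by
      intro h
      rw [card_eq_zero] at h
      have := sup_of_SP hp
      rw [h] at this
      exact hD.ne_empty this.symm
    rw [if_neg h0]
    by_cases h1 : p.card = 1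
    · rw [if_pos h1, if_pos (eq_singleton_of_SP hp h1), h1]; norm_num
    · rw [if_neg h1, if_neg]
      · simp
      · rintro rfl; simp at h1
  rw [Finset.sum_congr rfl (fun p hp => by rw [hin p hp])]
  rw [Finset.sum_eq_single {D}]
  · simp
  · intro p _ h; simp [h]
  · intro h; exact absurd (singleton_SP hD) h

lemma main (a : α → ℕ) (U : Finset α) (hU : 2 ≤ U.card) :
    ∑ p ∈ SP U, (∏ b ∈ p, (NN a b : ℚ)) * ∑ q ∈ SP p, (-1 : ℚ) ^ (p.card + q.card) *
      (Nat.multinomial q (fun c => (∑ b ∈ c, ∑ j ∈ b, a j) + 1) : ℚ) = 0 := by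
  set W := ∑ j ∈ U, a j with hW
  have h1 : ∀ p ∈ SP U, ∀ q ∈ SP p, (-1 : ℚ) ^ (p.card + q.card) *
      (Nat.multinomial q (fun c => (∑ b ∈ c, ∑ j ∈ b, a j) + 1) : ℚ) =
      ((-1) ^ q.card * ((W + q.card).factorial : ℚ)) *
        ∏ c ∈ q, ((-1) ^ c.card * ((((∑ b ∈ c, ∑ j ∈ b, a j) + 1).factorial : ℚ)⁻¹)) := by
    intro p hp q hq
    rw [multinomial_q, Finset.sum_add_distrib, sum_of_SP hq, sum_of_SP hp, ← hW,
      Finset.prod_mul_distrib, Finset.prod_pow_eq_pow_sum, card_of_SP hq, pow_add]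
    simp only [sum_const, smul_eq_mul, mul_one]
    ring
  rw [Finset.sum_congr rfl (fun p hp => by rw [Finset.sum_congr rfl (h1 p hp)])]
  rw [chain (fun b => (NN a b : ℚ)) (fun c => (-1) ^ c.card *
    ((((∑ b ∈ c, ∑ j ∈ b, a j) + 1).factorial : ℚ)⁻¹)) U.card U rfl
    (fun l => (-1) ^ l * ((W + l).factorial : ℚ))]
  have h2 : ∀ q ∈ SP U, ((-1) ^ q.card * ((W + q.card).factorial : ℚ)) *
      ∏ D ∈ q, ∑ p ∈ SP D, ((-1) ^ p.card * ((((∑ b ∈ p, ∑ j ∈ b, a j) + 1).factorial : ℚ)⁻¹)) *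
        ∏ b ∈ p, (NN a b : ℚ) =
      ((-1) ^ U.card * (W.factorial : ℚ) * ∏ i ∈ U, ((a i + 1).factorial : ℚ)⁻¹) *
        (ff (-((W : ℤ) + 1)) q.card * ∏ D ∈ q, P a D 1) := by
    intro q hq
    have h3 : ∀ D ∈ q, ∑ p ∈ SP D,
        ((-1) ^ p.card * ((((∑ b ∈ p, ∑ j ∈ b, a j) + 1).factorial : ℚ)⁻¹)) *
          ∏ b ∈ p, (NN a b : ℚ) =
        (-1) ^ D.card * (P a D 1 * ∏ i ∈ D, ((a i + 1).factorial : ℚ)⁻¹) := by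
      intro D hD
      have hne := nonempty_of_mem_SP hq hD
      have h4 : ∀ p ∈ SP D,
        ((-1) ^ p.card * ((((∑ b ∈ p, ∑ j ∈ b, a j) + 1).factorial : ℚ)⁻¹)) *
          ∏ b ∈ p, (NN a b : ℚ) = ((((∑ j ∈ D, a j) + 1).factorial : ℚ)⁻¹) *
            ((-1) ^ p.card * ∏ b ∈ p, (NN a b : ℚ)) := by
        intro p hp
        rw [sum_of_SP hp]; ring
      rw [Finset.sum_congr rfl h4, ← Finset.mul_sum, F_eq a D hne, multinomial_q,
        Finset.sum_add_distrib]
      simp only [sum_const, smul_eq_mul, mul_one]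
      rw [← P_one a D hne]
      have : (((∑ j ∈ D, a j) + 1).factorial : ℚ) ≠ 0 := by
        exact_mod_cast Nat.factorial_ne_zero _
      field_simp
    rw [Finset.prod_congr rfl h3, Finset.prod_mul_distrib, Finset.prod_mul_distrib,
      Finset.prod_pow_eq_pow_sum, card_of_SP hq, prod_of_SP hq, ← ff_neg]
    ring
  rw [Finset.sum_congr rfl h2, ← Finset.mul_sum, T_eq a U.card U rfl, hW, P_neg a U hU, mul_zero]

lemma image_val_inj (s : Finset α) :
    Function.Injective (fun b : Finset {x // x ∈ s} => b.image Subtype.val) :=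
  Finset.image_injective Subtype.val_injective

lemma bigN_eq (a : α → ℕ) (b : Finset α) :
    bigN (fun x : {x // x ∈ b} => a x.1) = NN a b := by
  rw [NN, ← sum_SP_sub, bigN]
  refine Finset.sum_congr rfl fun r _ => ?_
  rw [Finset.card_image_of_injective _ (image_val_inj b), Fintype.card_coe,
    Finset.prod_image (fun x _ y _ h => image_val_inj b h)]
  congr 1
  refine Finset.prod_congr rfl fun c _ => ?_
  simp only [Nat.multinomial]
  rw [Finset.sum_image (fun x _ y _ h => Subtype.ext h),
    Finset.prod_image (fun x _ y _ h => Subtype.ext h)]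

lemma lam_eq (w : α → ℕ) (s : Finset α) :
    lam (fun x : {x // x ∈ s} => w x.1) = ∑ q ∈ SP s, (-1 : ℤ) ^ (s.card + q.card) *
      (Nat.multinomial q (fun c => (∑ b ∈ c, w b) + 1) : ℤ) := by
  rw [← sum_SP_sub, lam]
  refine Finset.sum_congr rfl fun r _ => ?_
  rw [Finset.card_image_of_injective _ (image_val_inj s), Fintype.card_coe]
  congr 2
  simp only [Nat.multinomial]
  rw [Finset.sum_image (fun x _ y _ h => image_val_inj s h),
    Finset.prod_image (fun x _ y _ h => image_val_inj s h)]
  have : ∀ c : Finset {x // x ∈ s}, ∑ b ∈ c.image Subtype.val, w b = ∑ x ∈ c, w x.1 :=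
    fun c => Finset.sum_image (fun x _ y _ h => Subtype.ext h)
  simp only [this]

end KR

/-- Orthogonality: `∑_{p ∈ SP(B)} N_p · λ_{|p|} = 0`, where `N_p = ∏_i N_{p_i}` and
`λ_{|p|}` is `λ` applied to the multiset of block sums of `p`. -/
theorem stmt_15 (n : ℕ) (hn : 2 ≤ n) (a : Fin n → ℕ) :
    ∑ p : Finpartition (Finset.univ : Finset (Fin n)),
        (∏ b ∈ p.parts.attach, bigN (fun x : {x // x ∈ b.1} => a x.1)) *
          lam (fun b : {b // b ∈ p.parts} => ∑ j ∈ b.1, a j) = 0 := by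
  obtain ⟨F, hF⟩ : ∃ F : Finset (Finset (Fin n)) → ℤ, F = (fun p => (∏ b ∈ p, KR.NN a b) *
        ∑ q ∈ KR.SP p, (-1 : ℤ) ^ (p.card + q.card) *
          (Nat.multinomial q (fun c => (∑ b ∈ c, ∑ j ∈ b, a j) + 1) : ℤ)) := ⟨_, rfl⟩
  have h1 : ∀ p : Finpartition (Finset.univ : Finset (Fin n)),
      (∏ b ∈ p.parts.attach, bigN (fun x : {x // x ∈ b.1} => a x.1)) *
          lam (fun b : {b // b ∈ p.parts} => ∑ j ∈ b.1, a j) =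
      F p.parts := by
    intro p
    simp only [KR.bigN_eq, hF]
    rw [Finset.prod_attach p.parts (fun b => KR.NN a b),
      KR.lam_eq (fun b : Finset (Fin n) => ∑ j ∈ b, a j) p.parts]
  refine (Finset.sum_congr rfl (fun p _ => h1 p)).trans ((KR.sum_SP _ F).trans ?_)
  rw [hF]
  have := KR.main a (univ : Finset (Fin n)) (by simpa using hn)
  exact_mod_cast this
end
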